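/- For each k ∈ ℤ_{≥0} there is a constant C_k such that for all real u and all real τ > 0: if τ ≤ 1 then |G^{(k)}(u; τ)| ≤ C_k·τ^{−1/4}·(1 + τ^{1/2}|u|)·(1 + τ^{−k/2} + |u|^k), and if τ ≥ 1 then |G^{(k)}(u; τ)| ≤ C_k·τ^{1/4}·(1 + τ^{−1/2}|u|)·(1 + τ^{k/2} + |u|^k). -/

import Mathlib

open Complex Real MeasureTheory

noncomputable section

def chi (s : ℂ) : ℂ := (π : ℂ) ^ (s - 1/2) * Complex.Gamma ((1 - s)/2) / Complex.Gamma (s/2)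

def RSOmega : Set ℂ := {s : ℂ | s.im ≠ 0 ∨ (0 < s.re ∧ s.re < 1)}

def IsRSTheta (ϑ : ℂ → ℂ) : Prop :=
  DifferentiableOn ℂ ϑ RSOmega ∧ (∀ s ∈ RSOmega, Complex.exp (-2 * I * ϑ s) = chi s) ∧
    ϑ (1/2) = 0

def zetaSum (x : ℝ) (s : ℂ) : ℂ := ∑ n ∈ Finset.Icc 1 ⌊x⌋₊, (n : ℂ) ^ (-s)

def Upsilon (u τ : ℂ) : ℂ :=
  ∫ v : ℝ, Complex.exp (3 * (π:ℂ) * I / 4) *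
    (Complex.exp (-(π:ℂ) * I * τ * (1/2 + Complex.exp (3 * (π:ℂ) * I / 4) * v) ^ 2
        + 2 * (π:ℂ) * I * u * (1/2 + Complex.exp (3 * (π:ℂ) * I / 4) * v)) /
      (Complex.exp (2 * (π:ℂ) * I * (1/2 + Complex.exp (3 * (π:ℂ) * I / 4) * v)) - 1))

def G (u τ : ℂ) : ℂ :=
  τ ^ ((1:ℂ)/4) * Complex.exp (-(π:ℂ) * I * u ^ 2 / 2 + (π:ℂ) * I / 8) *
    Upsilon (τ ^ ((1:ℂ)/2) * u) τ

def Gderiv (k : ℕ) (u τ : ℂ) : ℂ := iteratedDeriv k (fun w => G w τ) u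

def hermiteH (n : ℕ) (x : ℂ) : ℂ :=
  (Nat.factorial n : ℂ) * ∑ j ∈ Finset.range (n / 2 + 1),
    (-1:ℂ) ^ j / ((Nat.factorial j : ℂ) * (Nat.factorial (n - 2*j) : ℂ)) * (2 * x) ^ (n - 2*j)

def obell (p : ℕ → ℂ) (i j : ℕ) : ℂ :=
  ∑ f ∈ (Finset.Nat.antidiagonalTuple j i).filter (fun f => ∀ l, 1 ≤ f l), ∏ l, p (f l)

def bernoulliPoly (n : ℕ) (x : ℂ) : ℂ := Polynomial.aeval x (Polynomial.bernoulli n)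

def fseq (σ : ℝ) (n : ℕ) : ℂ :=
  (bernoulliPoly (n+1) ((σ:ℂ)/2) + (-1:ℂ)^(n+1) * bernoulliPoly (n+1) ((1-(σ:ℂ))/2)) /
    (2*(n:ℂ)*((n:ℂ)+1))

def um (m : ℕ) (σ : ℝ) : ℂ :=
  (-2:ℂ)^m * ∑ k ∈ Finset.range (m+1), obell (fseq σ) m k / (Nat.factorial k : ℂ)

def seqA (j : ℕ) : ℂ := (-1:ℂ)^(j+1) / ((j:ℂ) + 2)

def seqB (j : ℕ) : ℂ := (-1:ℂ)^(j+1) / (j:ℂ)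

def dd (m r : ℕ) (σ : ℝ) : ℂ :=
  ∑ n ∈ Finset.Icc r m, (obell seqA n r / (Nat.factorial r : ℂ)) *
    ∑ k ∈ Finset.range (m - n + 1),
      (obell seqB (m - n) k / (Nat.factorial k : ℂ)) * ((σ:ℂ) - 1)^k

def qq (n ℓ : ℕ) (σ : ℝ) : ℂ :=
  ∑ m ∈ Finset.Icc (ℓ - n) (ℓ / 3), um m σ * dd (n - 2*m) (n + m - ℓ) σ

def PP (n k : ℕ) (x : ℂ) (σ : ℝ) : ℂ :=
  Complex.exp (3 * (π:ℂ) * I * (k:ℂ) / 4) * ∑ ℓ ∈ Finset.range (k/2 + 1),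
    (Nat.choose (3*n - 2*ℓ) (3*n - k) : ℂ) * (-1:ℂ)^(n + ℓ) * 2^(2*ℓ) / 2^k *
      qq n ℓ σ * hermiteH (k - 2*ℓ) (Complex.exp (-(π:ℂ) * I / 4) * x)

def IsAk (s : ℂ) (a : ℕ → ℂ) : Prop :=
  a 0 = 1 ∧ ∀ k : ℕ, ((k:ℂ) + 1) * (Real.sqrt s.im : ℂ) * a (k+1) =
    -((k:ℂ) + 1 - (s.re:ℂ)) * a k + I * (if 2 ≤ k then a (k-2) else 0)

def IsPsi (Ψ : ℂ → ℂ) : Prop :=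
  Differentiable ℂ Ψ ∧ ∀ u : ℂ, Complex.cos ((π:ℂ)*u) ≠ 0 →
    Ψ u = Complex.cos ((π:ℂ)*(u^2/2 - u - 1/8)) / Complex.cos ((π:ℂ)*u)

def wfun (s z : ℂ) : ℂ :=
  Complex.exp ((s - 1) * Complex.log (1 + z / (Real.sqrt s.im : ℂ))
    - I * (Real.sqrt s.im : ℂ) * z + I * z^2 / 2)

def rn (n : ℕ) (s z : ℂ) : ℂ :=
  wfun s z - ∑ k ∈ Finset.range n, (iteratedDeriv k (wfun s) 0 / (Nat.factorial k : ℂ)) * z^k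

def GammaOmega : Set ℂ := {s : ℂ | s.im ≠ 0 ∨ 0 < s.re}

def IsLogGamma (L : ℂ → ℂ) : Prop :=
  DifferentiableOn ℂ L GammaOmega ∧ (∀ s ∈ GammaOmega, Complex.exp (L s) = Complex.Gamma s) ∧
    L 1 = 0

def gseq (σ : ℝ) (n : ℕ) : ℂ := -(bernoulliPoly (n+1) (σ:ℂ)) / ((n:ℂ)*((n:ℂ)+1))

def gammam (m : ℕ) (σ : ℝ) : ℂ :=
  I^m * ∑ k ∈ Finset.range (m+1), obell (gseq σ) m k / (Nat.factorial k : ℂ)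


lemma int_cauchy (b : ℝ) (hb : 0 < b) :
    Integrable (fun x : ℝ => (1 + (x / b) ^ 2)⁻¹) ∧ ∫ x : ℝ, (1 + (x / b) ^ 2)⁻¹ = b * π := by
  constructor
  · exact (integrable_inv_one_add_sq).comp_div hb.ne'
  · rw [Measure.integral_comp_div (fun x : ℝ => (1 + x ^ 2)⁻¹) b, integral_univ_inv_one_add_sq,
      abs_of_pos hb, smul_eq_mul]

lemma cross_side (φ : ℂ → ℂ) (b : ℝ) (hb : 0 < b) (s : ℝ → ℝ) (M : ℝ → ℝ)
    (hM : Filter.Tendsto M Filter.atTop (nhds 0))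
    (h : ∀ᶠ R in Filter.atTop, ∀ y : ℝ, |y| ≤ b → ‖φ (s R + y * I)‖ ≤ M R) :
    Filter.Tendsto (fun R : ℝ => I • ∫ y in (-b)..b, φ (s R + y * I)) Filter.atTop (nhds 0) := by
  have h2 : Filter.Tendsto (fun R => M R * |b - (-b)|) Filter.atTop (nhds 0) := by
    simpa using hM.mul_const (|b - (-b)|)
  refine squeeze_zero_norm' ?_ h2
  filter_upwards [h] with R hR
  rw [norm_smul, Complex.norm_I, one_mul]
  apply intervalIntegral.norm_integral_le_of_norm_le_const
  intro y hy
  rw [Set.uIoc_of_le (by linarith)] at hy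
  exact hR y (abs_le.2 ⟨by linarith [hy.1], hy.2⟩)

lemma cross_lemma (q f : ℂ → ℂ) (b b' : ℝ) (hb : 0 < b) (hbb : b < b')
    (hq : DifferentiableOn ℂ q {z : ℂ | |z.im| < b'})
    (hf : ∀ z : ℂ, z ≠ 0 → |z.im| < b' → f z = q z / z)
    (hi1 : Integrable (fun x : ℝ => f (x + ((-b : ℝ) : ℂ) * I)))
    (hi2 : Integrable (fun x : ℝ => f (x + (b : ℂ) * I)))
    (M : ℝ → ℝ) (hM : Filter.Tendsto M Filter.atTop (nhds 0))
    (hd1 : ∀ᶠ R : ℝ in Filter.atTop, ∀ y : ℝ, |y| ≤ b → ‖f ((R : ℝ) + y * I)‖ ≤ M R)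
    (hd2 : ∀ᶠ R : ℝ in Filter.atTop, ∀ y : ℝ, |y| ≤ b → ‖f ((-R : ℝ) + y * I)‖ ≤ M R) :
    (∫ x : ℝ, f (x + ((-b : ℝ) : ℂ) * I)) - (∫ x : ℝ, f (x + (b : ℂ) * I)) = 2 * π * I * q 0 := by
  have hopen : IsOpen {z : ℂ | |z.im| < b'} :=
    isOpen_lt (by fun_prop) continuous_const
  have hφ : DifferentiableOn ℂ (dslope q 0) {z : ℂ | |z.im| < b'} :=
    (Complex.differentiableOn_dslope (hopen.mem_nhds (by simp; linarith))).2 hq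
  set φ := dslope q 0 with hφd
  have hφf : ∀ z : ℂ, z ≠ 0 → |z.im| < b' → φ z = f z - q 0 / z := by
    intro z hz hz'
    rw [hf z hz hz', hφd, dslope_of_ne _ hz, slope_def_field, sub_zero, sub_div]
  have hside : ∀ s : ℝ → ℝ, (∀ R, |s R| = |R|) →
      (∀ᶠ R : ℝ in Filter.atTop, ∀ y : ℝ, |y| ≤ b → ‖f ((s R : ℝ) + y * I)‖ ≤ M R) →
      Filter.Tendsto (fun R : ℝ => I • ∫ y in (-b)..b, φ (s R + y * I)) Filter.atTop (nhds 0) := by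
    intro s hs h
    refine cross_side φ b hb s (fun R => M R + ‖q 0‖ * R⁻¹) ?_ ?_
    · simpa using hM.add ((tendsto_inv_atTop_zero).const_mul (‖q 0‖))
    · filter_upwards [h, Filter.eventually_gt_atTop 0] with R hR hR0 y hy
      have hre : R ≤ ‖(s R : ℂ) + y * I‖ := by
        have := Complex.abs_re_le_norm ((s R : ℂ) + y * I)
        simp [hs] at this
        rwa [abs_of_pos hR0] at this
      have hne : (s R : ℂ) + y * I ≠ 0 := by
        intro h0; rw [h0, norm_zero] at hre; linarith
      rw [hφf _ hne (by simp; linarith)]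
      refine (norm_sub_le _ _).trans (add_le_add (hR y hy) ?_)
      rw [norm_div, div_eq_mul_inv]
      gcongr
  have t1 := hside (fun R => R) (fun R => rfl) hd1
  have t2 := hside (fun R => -R) (fun R => abs_neg R) hd2
  set ψ : ℝ → ℂ := fun x => (f (x + ((-b : ℝ) : ℂ) * I) - f (x + (b : ℂ) * I)) -
    (2 * I * q 0 / b) * (((1 + (x / b) ^ 2)⁻¹ : ℝ) : ℂ) with hψ
  obtain ⟨ic1, ic2⟩ := int_cauchy b hb
  have iψ : Integrable ψ := (hi1.sub hi2).sub (ic1.ofReal.const_mul _)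
  have eψ : ∫ x, ψ x = ((∫ x : ℝ, f (x + ((-b : ℝ) : ℂ) * I)) - (∫ x : ℝ, f (x + (b : ℂ) * I)))
      - 2 * π * I * q 0 := by
    have e1 : ∫ x, ψ x = (∫ x : ℝ, (f (x + ((-b : ℝ) : ℂ) * I) - f (x + (b : ℂ) * I))) -
        ∫ x : ℝ, (2 * I * q 0 / b) * (((1 + (x / b) ^ 2)⁻¹ : ℝ) : ℂ) :=
      integral_sub (hi1.sub hi2) (ic1.ofReal.const_mul _)
    rw [e1, integral_sub hi1 hi2, integral_const_mul, integral_complex_ofReal, ic2]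
    congr 1
    have : (b : ℂ) ≠ 0 := by exact_mod_cast hb.ne'
    push_cast
    field_simp
  have hne : ∀ (x y : ℝ), y ≠ 0 → (x : ℂ) + y * I ≠ 0 := by
    intro x y hy h
    have := congrArg Complex.im h
    simp at this
    exact hy this
  have ψeq : ∀ x : ℝ, φ (x + ((-b : ℝ) : ℂ) * I) - φ (x + (b : ℂ) * I) = ψ x := by
    intro x
    have n1 := hne x (-b) (by linarith)
    have n2 := hne x b (by linarith)
    rw [hφf _ n1 (by simp [abs_of_pos hb]; linarith), hφf _ n2 (by simp [abs_of_pos hb]; linarith)]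
    simp only [hψ]
    have hb0 : (b : ℂ) ≠ 0 := by exact_mod_cast hb.ne'
    have h3 : (1 + ((x : ℂ) / b) ^ 2) ≠ 0 := by
      have : (0 : ℝ) < 1 + (x / b) ^ 2 := by positivity
      exact_mod_cast this.ne'
    have key : q 0 / ((x : ℂ) + ((-b : ℝ) : ℂ) * I) - q 0 / ((x : ℂ) + b * I) =
        (2 * I * q 0 / b) * (((1 + (x / b) ^ 2)⁻¹ : ℝ) : ℂ) := by
      push_cast at n1 ⊢
      have h4 : (x:ℂ) ^ 2 + b ^ 2 = (x + -b * I) * (x + b * I) := by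
        ring_nf; rw [Complex.I_sq]; ring
      have h5 : (1 + ((x : ℂ) / b) ^ 2) = (x + -b * I) * (x + b * I) / b ^ 2 := by
        rw [← h4]; field_simp; ring
      rw [h5]
      clear h3 h4 h5
      generalize hA : (x:ℂ) + -b * I = A at *
      generalize hB : (x:ℂ) + b * I = B at *
      have hAB : 2 * I * b = B - A := by rw [← hA, ← hB]; ring
      have : 2 * I * q 0 / b * (A * B / (b:ℂ) ^ 2)⁻¹ = q 0 * (2 * I * b) / (A * B) := by
        field_simp
      rw [this, hAB]
      field_simp
    rw [← key]; ring
  have hcont : ∀ y : ℝ, |y| < b' → Continuous (fun x : ℝ => φ (x + (y : ℂ) * I)) := by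
    intro y hy
    have := hφ.continuousOn
    refine this.comp_continuous (by fun_prop) ?_
    intro x; simpa using hy
  have hc1 := hcont (-b) (by simp [abs_of_pos hb]; linarith)
  have hc2 := hcont b (by simp [abs_of_pos hb]; linarith)
  have rect : ∀ R : ℝ, (∫ x in (-R)..R, ψ x) + (I • ∫ y in (-b)..b, φ ((R : ℝ) + y * I))
      - (I • ∫ y in (-b)..b, φ ((-R : ℝ) + y * I)) = 0 := by
    intro R
    have := Complex.integral_boundary_rect_eq_zero_of_differentiableOn φ (⟨-R, -b⟩ : ℂ) (⟨R, b⟩ : ℂ)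
      (hφ.mono ?_)
    · simp only at this
      rw [← intervalIntegral.integral_sub (hc1.intervalIntegrable _ _)
        (hc2.intervalIntegrable _ _)] at this
      simp only [ψeq] at this
      exact this
    · intro z hz
      have h2 := hz.2
      simp only [Set.mem_preimage, Set.uIcc_of_le (show -b ≤ b by linarith)] at h2
      exact lt_of_le_of_lt (abs_le.2 h2) hbb
  have t3 : Filter.Tendsto (fun R : ℝ => ∫ x in (-R)..R, ψ x) Filter.atTop (nhds (∫ x, ψ x)) :=
    MeasureTheory.intervalIntegral_tendsto_integral iψ Filter.tendsto_neg_atTop_atBot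
      Filter.tendsto_id
  have t4 := (t3.add t1).sub t2
  simp only [rect] at t4
  have := tendsto_nhds_unique t4 tendsto_const_nhds
  rw [add_zero, sub_zero, eψ] at this
  exact sub_eq_zero.1 this

def om : ℂ := Complex.exp (3 * (π:ℂ) * I / 4)

def hh (τ : ℝ) (w z : ℂ) : ℂ := Complex.exp (-(π:ℂ) * I * τ * z ^ 2 + 2 * (π:ℂ) * I * w * z)

def gg (τ : ℝ) (w z : ℂ) : ℂ := hh τ w z / (Complex.exp (2 * (π:ℂ) * I * z) - 1)

lemma om_eq : om = ((-(√2/2) : ℝ) : ℂ) + ((√2/2 : ℝ) : ℂ) * I := by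
  have : (3 * (π:ℂ) * I / 4) = ((π - π/4 : ℝ) : ℂ) * I := by push_cast; ring
  rw [om, this, Complex.exp_mul_I, ← Complex.ofReal_cos, ← Complex.ofReal_sin, Real.cos_pi_sub,
    Real.sin_pi_sub, Real.cos_pi_div_four, Real.sin_pi_div_four]

lemma om_re : om.re = -(√2/2) := by rw [om_eq]; simp
lemma om_im : om.im = √2/2 := by rw [om_eq]; simp

lemma om_norm : ‖om‖ = 1 := by
  have : (3 * (π:ℂ) * I / 4) = ((3 * π/4 : ℝ) : ℂ) * I := by push_cast; ring
  rw [om, this, Complex.norm_exp_ofReal_mul_I]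

lemma om_ne : om ≠ 0 := Complex.exp_ne_zero _

lemma om_sq : om ^ 2 = -I := by
  have h : ((√2 : ℝ) : ℂ) ^ 2 = 2 := by
    rw [← Complex.ofReal_pow, Real.sq_sqrt (by norm_num)]; norm_num
  rw [om_eq]; push_cast
  ring_nf
  rw [h, Complex.I_sq]; ring

/-- The coordinate change. -/
lemma om_coord (c x y : ℝ) : (c : ℂ) + om * (x + y * I) = ((c - √2 * y : ℝ) : ℂ) + om * ((x - y : ℝ) : ℂ) := by
  rw [om_eq]; push_cast; ring_nf; rw [Complex.I_sq]; ring

lemma Ups_eq (w : ℂ) (τ : ℝ) : Upsilon w τ = ∫ v : ℝ, om * gg τ w ((1/2 : ℝ) + om * v) := by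
  simp only [Upsilon, gg, hh, om]; push_cast; rfl

lemma num_bound (τ : ℝ) (hτ : 0 < τ) (w c : ℂ) (v : ℝ) :
    ‖hh τ w (c + om * v)‖ ≤ ‖Complex.exp (π * I * w ^ 2 / τ)‖ *
      Real.exp (-(π * τ) * v ^ 2 + 2 * π * τ * ‖c - w / τ‖ * |v| + π * τ * ‖c - w / τ‖ ^ 2) := by
  have ht : (τ : ℂ) ≠ 0 := by exact_mod_cast hτ.ne'
  have e : hh τ w (c + om * v) = Complex.exp (π * I * w ^ 2 / τ) *
      Complex.exp (((-(π * τ) * v ^ 2 : ℝ) : ℂ) + (-(2 * π * I * τ * om * v * (c - w / τ)) +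
        -(π * I * τ * (c - w / τ) ^ 2))) := by
    rw [hh, ← Complex.exp_add]
    congr 1
    push_cast
    have : ∀ o : ℂ, o ^ 2 = -I → -(π:ℂ) * I * τ * (c + o * v) ^ 2 + 2 * π * I * w * (c + o * v) =
      π * I * w ^ 2 / τ + (-(π * τ) * v ^ 2 + (-(2 * π * I * τ * o * v * (c - w / τ)) +
        -(π * I * τ * (c - w / τ) ^ 2))) := by
      intro o ho
      field_simp
      ring_nf
      rw [ho]
      ring_nf
      rw [Complex.I_sq]; ring
    exact this om om_sq
  rw [e, norm_mul]
  gcongr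
  rw [Complex.norm_exp]
  apply Real.exp_le_exp.2
  rw [Complex.add_re, Complex.ofReal_re, add_assoc]
  gcongr
  refine (Complex.re_le_norm _).trans ((norm_add_le _ _).trans (le_of_eq ?_))
  simp [om_norm, abs_of_pos hτ, abs_of_pos Real.pi_pos]
  ring

lemma quad_le (a b x : ℝ) (ha : 0 < a) : -a * x ^ 2 + b * |x| ≤ -(a / 2) * x ^ 2 + b ^ 2 / (2 * a) := by
  have h : b ^ 2 / (2 * a) - b * |x| + a / 2 * |x| ^ 2 = (b - a * |x|) ^ 2 / (2 * a) := by
    field_simp; ring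
  have : 0 ≤ (b - a * |x|) ^ 2 / (2 * a) := by positivity
  rw [sq_abs] at h
  linarith

lemma int_bound (a b : ℝ) (ha : 0 < a) : Integrable (fun x : ℝ => Real.exp (-a * x ^ 2 + b * |x|)) := by
  have := (integrable_exp_neg_mul_sq (show 0 < a / 2 by linarith)).mul_const (Real.exp (b ^ 2 / (2 * a)))
  refine this.mono' (by fun_prop) (Filter.Eventually.of_forall fun x => ?_)
  rw [Real.norm_eq_abs, abs_of_pos (Real.exp_pos _), ← Real.exp_add]
  exact Real.exp_le_exp.2 (quad_le a b x ha)

lemma int_bound_le (a b : ℝ) (ha : 0 < a) :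
    ∫ x : ℝ, Real.exp (-a * x ^ 2 + b * |x|) ≤ √(2 * π / a) * Real.exp (b ^ 2 / (2 * a)) := by
  have h1 := (integrable_exp_neg_mul_sq (show 0 < a / 2 by linarith)).mul_const (Real.exp (b ^ 2 / (2 * a)))
  refine (integral_mono (int_bound a b ha) h1 fun x => ?_).trans (le_of_eq ?_)
  · simp only []
    rw [← Real.exp_add]
    exact Real.exp_le_exp.2 (quad_le a b x ha)
  · rw [integral_mul_const, integral_gaussian]
    congr 2; field_simp

lemma den_norm (c v : ℝ) : Complex.exp (2 * (π:ℂ) * I * (c + om * v)) =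
    ((Real.exp (-(√2 * π * v)) : ℝ) : ℂ) * Complex.exp (((2 * π * c - √2 * π * v : ℝ) : ℂ) * I) := by
  rw [Complex.ofReal_exp, ← Complex.exp_add]
  congr 1
  rw [om_eq]; push_cast; ring_nf; rw [Complex.I_sq]; ring

lemma norm_sub_one_sq (r θ : ℝ) : ‖(r : ℂ) * Complex.exp ((θ : ℂ) * I) - 1‖ ^ 2 =
    (r - 1) ^ 2 + 4 * r * Real.sin (θ / 2) ^ 2 := by
  rw [← Complex.normSq_eq_norm_sq, Complex.normSq_apply, Complex.exp_mul_I, ← Complex.ofReal_cos,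
    ← Complex.ofReal_sin]
  simp only [Complex.sub_re, Complex.mul_re, Complex.add_re, Complex.ofReal_re, Complex.ofReal_im,
    Complex.I_re, Complex.I_im, Complex.mul_im, Complex.add_im, Complex.sub_im, Complex.one_re,
    Complex.one_im]
  have h1 : Real.cos θ = 1 - 2 * Real.sin (θ/2) ^ 2 := by
    have := Real.cos_sq_add_sin_sq (θ/2)
    have h2 := Real.cos_two_mul (θ/2)
    rw [show 2 * (θ/2) = θ by ring] at h2
    linarith
  have h3 := Real.cos_sq_add_sin_sq θ
  have h4 : Real.sin (θ/2) ^ 2 = (1 - Real.cos θ) / 2 := by linarith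
  rw [h4]
  linear_combination r ^ 2 * h3

lemma den_lb (δ c v : ℝ) (hδ : 0 < δ) (hδ2 : δ ≤ 1/2) (h1 : δ ≤ c) (h2 : c ≤ 1 - δ) :
    δ / 4 * max 1 (Real.exp (-(√2 * π * v))) ≤
      ‖Complex.exp (2 * (π:ℂ) * I * (c + om * v)) - 1‖ := by
  rw [den_norm]
  set s := √2 * π * v with hs
  have hpi := Real.pi_gt_three
  have hpi4 := Real.pi_lt_four
  set r := Real.exp (-s) with hr
  have hr0 : 0 < r := Real.exp_pos _
  have hsq := norm_sub_one_sq r (2 * π * c - s)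
  set N := ‖(r : ℂ) * Complex.exp (((2 * π * c - s : ℝ) : ℂ) * I) - 1‖ with hN
  have hN0 : 0 ≤ N := norm_nonneg _
  by_cases hcase : π * δ ≤ |s|
  · have hA : |r - 1| ≤ N := by
      apply abs_le_of_sq_le_sq _ hN0
      have := mul_nonneg (mul_nonneg (by norm_num : (0:ℝ) ≤ 4) hr0.le) (sq_nonneg (Real.sin ((2 * π * c - s)/2)))
      linarith
    refine le_trans ?_ hA
    have hpd : 1 + π * δ ≤ Real.exp |s| := by
      have := Real.add_one_le_exp |s|; linarith
    have hπδ : δ * (1 + π * δ) ≤ π * δ := by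
      have h7 : π * δ ≤ π * (1/2) := by gcongr
      have : 1 + π * δ ≤ π := by linarith
      rw [mul_comm π δ] at this ⊢
      gcongr
    rcases le_total 0 s with h | h
    · rw [abs_of_nonneg h] at hpd
      have hrs : r * Real.exp s = 1 := by rw [hr, ← Real.exp_add]; simp
      have hr1 : r ≤ 1 := by rw [hr]; exact Real.exp_le_one_iff.2 (by linarith)
      rw [max_eq_left hr1, abs_of_nonpos (by linarith)]
      have : r * (1 + π * δ) ≤ 1 := (mul_le_mul_of_nonneg_left hpd hr0.le).trans hrs.le
      have h3 : δ ≤ 1 - r := by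
        by_contra hcon
        push Not at hcon
        nlinarith
      linarith
    · rw [abs_of_nonpos h, ← hr] at hpd
      have hr1 : 1 ≤ r := by nlinarith
      rw [max_eq_right hr1, abs_of_nonneg (by linarith)]
      nlinarith
  · push Not at hcase
    have hs1 := abs_lt.1 hcase
    have hsin : δ ≤ Real.sin ((2 * π * c - s)/2) := by
      have key : ∀ x, π * δ / 2 ≤ x → x ≤ π / 2 → δ ≤ Real.sin x := by
        intro x hx hx2
        have h0 : 0 ≤ x := le_trans (by positivity) hx
        refine le_trans ?_ (Real.mul_le_sin h0 hx2)
        rw [div_mul_eq_mul_div, le_div_iff₀ (by positivity)]; linarith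
      have b1 : π * δ ≤ π * c := by gcongr
      have b2 : π * c ≤ π * (1 - δ) := by gcongr
      rcases le_total ((2 * π * c - s)/2) (π/2) with h | h
      · exact key _ (by linarith) h
      · rw [← Real.sin_pi_sub]
        exact key _ (by linarith) (by linarith)
    have hN2 : 4 * r * δ ^ 2 ≤ N ^ 2 := by
      rw [hsq]
      have : δ ^ 2 ≤ Real.sin ((2 * π * c - s)/2) ^ 2 := by gcongr
      nlinarith [sq_nonneg (r - 1)]
    have hex : Real.exp 2 ≤ 8 := by
      have := Real.exp_one_lt_d9
      have e2 : Real.exp 2 = Real.exp 1 * Real.exp 1 := by rw [← Real.exp_add]; norm_num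
      rw [e2]; nlinarith [Real.exp_pos 1]
    have hs2 : |s| ≤ 2 := by nlinarith
    have hs3 := abs_le.1 hs2
    have hrle : r ≤ 8 := (Real.exp_le_exp.2 (by linarith)).trans hex
    have hrge : 1 ≤ 8 * r := by
      have : r * Real.exp s = 1 := by rw [hr, ← Real.exp_add]; simp
      have h8 : Real.exp s ≤ 8 := (Real.exp_le_exp.2 (by linarith)).trans hex
      rw [← this]; nlinarith
    apply le_of_sq_le_sq _ hN0
    refine le_trans ?_ hN2
    have : max 1 r ^ 2 ≤ 64 * r := by
      rcases max_choice 1 r with h | h <;> rw [h] <;> nlinarith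
    nlinarith [sq_nonneg δ]

lemma sq2 : √2 * √2 = (2:ℝ) := Real.mul_self_sqrt (by norm_num)

lemma den_ne (c v : ℝ) (h0 : 0 < c) (h1 : c < 1) :
    Complex.exp (2 * (π:ℂ) * I * (c + om * v)) - 1 ≠ 0 := by
  have hδ : 0 < min c (1 - c) := lt_min h0 (by linarith)
  have hδ2 : min c (1 - c) ≤ 1/2 := by
    rcases le_total c (1-c) with h | h
    · rw [min_eq_left h]; linarith
    · rw [min_eq_right h]; linarith
  have := den_lb (min c (1-c)) c v hδ hδ2 (min_le_left _ _) (by linarith [min_le_right c (1-c)])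
  intro h
  rw [h, norm_zero] at this
  have h2 : 0 < min c (1-c) / 4 * max 1 (Real.exp (-(√2 * π * v))) := by positivity
  linarith

lemma gg_bound (τ : ℝ) (hτ : 0 < τ) (w : ℂ) (δ c v : ℝ) (hδ : 0 < δ) (hδ2 : δ ≤ 1/2) (h1 : δ ≤ c)
    (h2 : c ≤ 1 - δ) : ‖om * gg τ w (c + om * v)‖ ≤ 4 / δ * (‖Complex.exp (π * I * w ^ 2 / τ)‖ *
      Real.exp (-(π * τ) * v ^ 2 + 2 * π * τ * ‖c - w / τ‖ * |v| + π * τ * ‖c - w / τ‖ ^ 2)) := by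
  have hd := den_lb δ c v hδ hδ2 h1 h2
  have hn := num_bound τ hτ w c v
  have hd' : δ / 4 ≤ ‖Complex.exp (2 * (π:ℂ) * I * (c + om * v)) - 1‖ := by
    refine le_trans ?_ hd
    have := le_max_left 1 (Real.exp (-(√2 * π * v)))
    nlinarith
  rw [norm_mul, om_norm, one_mul, gg, norm_div]
  rw [div_le_iff₀ (lt_of_lt_of_le (by positivity) hd')]
  refine hn.trans ?_
  set X := ‖Complex.exp (π * I * w ^ 2 / τ)‖ *
      Real.exp (-(π * τ) * v ^ 2 + 2 * π * τ * ‖c - w / τ‖ * |v| + π * τ * ‖c - w / τ‖ ^ 2)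
  have hX : 0 ≤ X := by positivity
  calc X = 4 / δ * X * (δ / 4) := by field_simp
    _ ≤ _ := by gcongr

lemma hh_cont (τ : ℝ) (w : ℂ) : Continuous (hh τ w) := by unfold hh; fun_prop

lemma hh_diff (τ : ℝ) (w : ℂ) : Differentiable ℂ (hh τ w) := by unfold hh; fun_prop

lemma gg_cont (τ : ℝ) (w : ℂ) (c : ℝ) (h0 : 0 < c) (h1 : c < 1) :
    Continuous (fun v : ℝ => om * gg τ w (c + om * v)) := by
  unfold gg
  refine continuous_const.mul (Continuous.div ?_ (by fun_prop) (fun v => den_ne c v h0 h1))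
  exact (hh_cont τ w).comp (by fun_prop)

lemma gg_int (τ : ℝ) (hτ : 0 < τ) (w : ℂ) (c : ℝ) (h0 : 0 < c) (h1 : c < 1) :
    Integrable (fun v : ℝ => om * gg τ w (c + om * v)) := by
  have hδ : 0 < min c (1 - c) := lt_min h0 (by linarith)
  have hδ2 : min c (1 - c) ≤ 1/2 := by
    rcases le_total c (1-c) with h | h
    · rw [min_eq_left h]; linarith
    · rw [min_eq_right h]; linarith
  have hB := (((int_bound (π * τ) (2 * π * τ * ‖(c:ℂ) - w / τ‖) (by positivity)).mul_const
    (Real.exp (π * τ * ‖(c:ℂ) - w / τ‖ ^ 2))).const_mul (‖Complex.exp (π * I * w ^ 2 / τ)‖)).const_mul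
    (4 / min c (1-c))
  refine hB.mono' (gg_cont τ w c h0 h1).aestronglyMeasurable
    (Filter.Eventually.of_forall fun v => ?_)
  have := gg_bound τ hτ w (min c (1-c)) c v hδ hδ2 (min_le_left _ _)
    (by linarith [min_le_right c (1-c)])
  rw [Real.exp_add _ (π * τ * ‖(c:ℂ) - w / τ‖ ^ 2)] at this
  exact this

lemma Ups_diff (τ : ℝ) (hτ : 0 < τ) : Differentiable ℂ (fun w => Upsilon w τ) := by
  intro w0
  simp only [Ups_eq]
  set z : ℝ → ℂ := fun v => ((1/2 : ℝ) : ℂ) + om * v with hz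
  have hzn : ∀ v, ‖z v‖ ≤ 1/2 + |v| := by
    intro v
    refine (norm_add_le _ _).trans (le_of_eq ?_)
    rw [norm_mul, om_norm]; simp
  have hgc : ∀ w, Continuous (fun v : ℝ => om * gg τ w (z v)) := fun w =>
    gg_cont τ w (1/2) (by norm_num) (by norm_num)
  have := hasDerivAt_integral_of_dominated_loc_of_deriv_le (μ := volume) (x₀ := w0)
    (F := fun w v => om * gg τ w (z v)) (s := Metric.ball w0 1)
    (F' := fun w v => (2 * π * I * z v) * (om * gg τ w (z v)))
    (bound := fun v => Real.exp (-(π * τ) * v ^ 2 + (π * τ + 2 * π * (‖w0‖ + 2)) * |v|) *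
      (8 * Real.exp (π * τ / 4 + π * (‖w0‖ + 2))))
    (Metric.ball_mem_nhds _ one_pos)
    (Filter.Eventually.of_forall fun w => (hgc w).aestronglyMeasurable)
    (gg_int τ hτ w0 (1/2) (by norm_num) (by norm_num))
    (Continuous.aestronglyMeasurable (by
      have := hgc w0
      refine Continuous.mul ?_ this
      fun_prop)) ?_ ((int_bound _ _ (by positivity)).mul_const _) ?_
  · exact this.2.differentiableAt
  · refine Filter.Eventually.of_forall fun v w hw => ?_
    have hw' : ‖w‖ ≤ ‖w0‖ + 1 := by
      have h1 : ‖w - w0‖ < 1 := by simpa [dist_eq_norm] using hw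
      have h2 := norm_add_le w0 (w - w0)
      rw [add_sub_cancel] at h2
      linarith
    have hgw : om * gg τ w (z v) = (om * gg τ 0 (z v)) * Complex.exp (2 * π * I * w * z v) := by
      simp only [gg, hh]
      rw [mul_zero, zero_mul, add_zero, Complex.exp_add]; ring
    have hb := gg_bound τ hτ 0 (1/2) (1/2) v (by norm_num) le_rfl le_rfl (by norm_num)
    have hn : ‖((1/2 : ℝ) : ℂ) - 0 / (τ : ℂ)‖ = 1/2 := by rw [zero_div, sub_zero]; simp
    rw [hn] at hb
    have hb2 : ‖om * gg τ 0 (z v)‖ ≤ 8 * Real.exp (-(π * τ) * v ^ 2 + π * τ * |v| + π * τ / 4) := by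
      refine hb.trans (le_of_eq ?_)
      simp
      ring_nf
    have he : ‖Complex.exp (2 * π * I * w * z v)‖ ≤ Real.exp (2 * π * (‖w0‖ + 1) * (1/2 + |v|)) := by
      refine (Complex.norm_exp_le_exp_norm _).trans (Real.exp_le_exp.2 ?_)
      rw [norm_mul, norm_mul]
      have : ‖2 * (π:ℂ) * I‖ = 2 * π := by simp [abs_of_pos Real.pi_pos]
      rw [this]
      gcongr
      exact hzn v
    have hp : ‖2 * (π:ℂ) * I * z v‖ ≤ Real.exp (2 * π * (1/2 + |v|)) := by
      rw [norm_mul]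
      have : ‖2 * (π:ℂ) * I‖ = 2 * π := by simp [abs_of_pos Real.pi_pos]
      rw [this]
      have h1 : 2 * π * ‖z v‖ ≤ 2 * π * (1/2 + |v|) := by gcongr; exact hzn v
      linarith [Real.add_one_le_exp (2 * π * (1/2 + |v|))]
    rw [norm_mul, hgw, norm_mul (om * gg τ 0 (z v))]
    calc _ ≤ Real.exp (2 * π * (1/2 + |v|)) * ((8 * Real.exp (-(π * τ) * v ^ 2 + π * τ * |v| + π * τ / 4))
          * Real.exp (2 * π * (‖w0‖ + 1) * (1/2 + |v|))) := by gcongr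
      _ = 8 * Real.exp ((2 * π * (1/2 + |v|)) + (-(π * τ) * v ^ 2 + π * τ * |v| + π * τ / 4)
          + (2 * π * (‖w0‖ + 1) * (1/2 + |v|))) := by
          rw [Real.exp_add _ (2 * π * (‖w0‖ + 1) * (1/2 + |v|)), Real.exp_add (2 * π * (1/2 + |v|))]; ring
      _ = _ := by
          rw [show ∀ a b : ℝ, Real.exp a * (8 * Real.exp b) = 8 * Real.exp (a + b) from
            fun a b => by rw [Real.exp_add]; ring]
          congr 2; ring
  · refine Filter.Eventually.of_forall fun v w hw => ?_
    have h1 : HasDerivAt (fun w : ℂ => Complex.exp (-(π:ℂ) * I * τ * z v ^ 2 + 2 * (π:ℂ) * I * w * z v))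
        (Complex.exp (-(π:ℂ) * I * τ * z v ^ 2 + 2 * (π:ℂ) * I * w * z v) * (2 * π * I * z v)) w := by
      apply HasDerivAt.cexp
      apply HasDerivAt.const_add
      have := ((hasDerivAt_id w).const_mul (2 * (π:ℂ) * I)).mul_const (z v)
      simpa using this
    have h2 := (h1.div_const (Complex.exp (2 * (π:ℂ) * I * z v) - 1)).const_mul om
    simp only [gg, hh]
    refine h2.congr_deriv ?_
    ring

lemma E1 (τ : ℝ) (hτ : 0 < τ) (w : ℂ) :
    ‖Upsilon (w + 1) τ - Upsilon w τ‖ ≤ (√τ)⁻¹ * ‖Complex.exp (π * I * w ^ 2 / τ)‖ := by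
  rw [Ups_eq, Ups_eq, ← integral_sub (gg_int τ hτ _ (1/2) (by norm_num) (by norm_num))
    (gg_int τ hτ _ (1/2) (by norm_num) (by norm_num))]
  have hpt : ∀ v : ℝ, om * gg τ (w+1) ((1/2 : ℝ) + om * v) - om * gg τ w ((1/2 : ℝ) + om * v) =
      om * Complex.exp ((-(π * τ) : ℂ) * v ^ 2 + (π * I * om * (2 * w - τ)) * v
        + (-(π * I * τ / 4) + π * I * w)) := by
    intro v
    have hne := den_ne (1/2) v (by norm_num) (by norm_num)
    have e1 : hh τ (w+1) ((1/2 : ℝ) + om * v) = hh τ w ((1/2 : ℝ) + om * v) *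
        Complex.exp (2 * π * I * ((1/2 : ℝ) + om * v)) := by
      rw [hh, hh, ← Complex.exp_add]; congr 1; ring
    have e2 : hh τ w ((1/2 : ℝ) + om * v) = Complex.exp ((-(π * τ) : ℂ) * v ^ 2 + (π * I * om * (2 * w - τ)) * v
        + (-(π * I * τ / 4) + π * I * w)) := by
      rw [hh]; congr 1
      have : ∀ o : ℂ, o ^ 2 = -I → -(π:ℂ) * I * τ * ((1/2 : ℝ) + o * v) ^ 2 + 2 * π * I * w * ((1/2 : ℝ) + o * v)
          = (-(π * τ) : ℂ) * v ^ 2 + (π * I * o * (2 * w - τ)) * v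
        + (-(π * I * τ / 4) + π * I * w) := by
        intro o ho
        push_cast
        ring_nf
        rw [ho]
        ring_nf
        rw [Complex.I_sq]; ring
      exact this om om_sq
    rw [← e2, gg, gg, e1, ← mul_sub, ← sub_div, ← mul_sub_one, mul_div_assoc, div_self hne, mul_one]
  simp only [hpt]
  rw [integral_const_mul, integral_cexp_quadratic (by
    simp; positivity)]
  rw [norm_mul, om_norm, one_mul, norm_mul]
  have hp : (π:ℂ) ≠ 0 := by exact_mod_cast Real.pi_ne_zero
  have ht : (τ:ℂ) ≠ 0 := by exact_mod_cast hτ.ne'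
  have h1 : (π:ℂ) / - -(π * τ) = ((τ⁻¹ : ℝ) : ℂ) := by push_cast; field_simp
  rw [h1, Complex.norm_cpow_eq_rpow_re_of_pos (by positivity)]
  have h2 : ((-(π * I * τ / 4) + π * I * w) - (π * I * om * (2 * w - τ)) ^ 2 / (4 * (-(π * τ) : ℂ)))
      = π * I * w ^ 2 / τ := by
    have : (π * I * om * (2 * w - τ)) ^ 2 = π ^ 2 * I ^ 2 * om ^ 2 * (2 * w - τ) ^ 2 := by ring
    rw [this, om_sq, Complex.I_sq]
    field_simp; ring
  rw [h2]
  gcongr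
  have : ((1:ℂ)/2).re = 1/2 := by norm_num
  rw [this, ← Real.sqrt_eq_rpow, Real.sqrt_inv]

lemma den_zero (c x y : ℝ) (h : Complex.exp (2 * (π:ℂ) * I * (c + om * (x + y * I))) = 1) :
    x = y ∧ ∃ n : ℤ, c - √2 * y = n := by
  obtain ⟨n, hn⟩ := Complex.exp_eq_one_iff.1 h
  rw [om_coord] at hn
  have h2 : (2 * (π:ℂ) * I) ≠ 0 := Complex.two_pi_I_ne_zero
  rw [mul_comm (n:ℂ)] at hn
  have h3 := mul_left_cancel₀ h2 hn
  have him := congrArg Complex.im h3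
  have hre := congrArg Complex.re h3
  simp [om_im] at him
  simp [om_re] at hre
  have hxy : x = y := by linarith
  refine ⟨hxy, n, ?_⟩
  rw [hxy, sub_self, mul_zero] at hre
  linarith

lemma den_far (c x y : ℝ) (h : 1 ≤ |x - y|) :
    1/2 ≤ ‖Complex.exp (2 * (π:ℂ) * I * (c + om * (x + y * I))) - 1‖ := by
  rw [om_coord]
  have hd := den_norm (c - √2 * y) (x - y)
  set E := Complex.exp (2 * (π:ℂ) * I * (((c - √2 * y : ℝ) : ℂ) + om * ((x - y : ℝ) : ℂ)))
  have hE : ‖E‖ = Real.exp (-(√2 * π * (x - y))) := by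
    rw [hd, norm_mul, Complex.norm_exp_ofReal_mul_I, mul_one, Complex.norm_real, Real.norm_eq_abs,
      abs_of_pos (Real.exp_pos _)]
  have hs : 1 ≤ √2 := by rw [Real.one_le_sqrt]; norm_num
  have hpi := Real.pi_gt_three
  have hsp : 1 ≤ √2 * π := by nlinarith
  rcases le_abs.1 h with h' | h'
  · have h1 := norm_sub_norm_le (1:ℂ) E
    rw [norm_sub_rev, norm_one, hE] at h1
    have h2 : 2 ≤ Real.exp (√2 * π * (x - y)) := by
      have := Real.add_one_le_exp (√2 * π * (x - y)); nlinarith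
    rw [Real.exp_neg] at h1
    have h3 : (Real.exp (√2 * π * (x - y)))⁻¹ ≤ 2⁻¹ := by gcongr
    linarith
  · have h1 := norm_sub_norm_le E (1:ℂ)
    rw [norm_one, hE] at h1
    have := Real.add_one_le_exp (-(√2 * π * (x - y)))
    nlinarith

lemma side_one (τ : ℝ) (hτ : 0 < τ) (w : ℂ) (c b : ℝ) (x y : ℝ) (hy : |y| ≤ b)
    (hx : b + 1 ≤ |x|) :
    ‖om * gg τ w (c + om * (x + y * I))‖ ≤ 2 * ‖Complex.exp (π * I * w ^ 2 / τ)‖ *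
      Real.exp (-(π * τ) * |x| ^ 2 + 2 * π * τ * (|c| + b + ‖w / τ‖) * |x| +
        π * τ * (|c| + b + ‖w / τ‖) ^ 2) := by
  have hd := den_far c x y (by
    have := abs_sub_abs_le_abs_sub x y
    linarith)
  have hn := num_bound τ hτ w (c + om * (y * I)) x
  have e : (c:ℂ) + om * (x + y * I) = (c + om * (y * I)) + om * x := by ring
  rw [norm_mul, om_norm, one_mul, gg, norm_div, div_le_iff₀ (by linarith), e]
  rw [e] at hd
  have hε : ‖(c + om * (y * I)) - w / τ‖ ≤ |c| + b + ‖w / τ‖ := by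
    refine (norm_sub_le _ _).trans ?_
    gcongr
    refine (norm_add_le _ _).trans ?_
    rw [norm_mul, norm_mul, om_norm, Complex.norm_I, Complex.norm_real, Complex.norm_real]
    simpa using hy
  have h3 : ‖hh τ w ((c + om * (y * I)) + om * x)‖ ≤ ‖Complex.exp (π * I * w ^ 2 / τ)‖ *
      Real.exp (-(π * τ) * |x| ^ 2 + 2 * π * τ * (|c| + b + ‖w / τ‖) * |x| +
        π * τ * (|c| + b + ‖w / τ‖) ^ 2) := by
    refine hn.trans ?_
    rw [sq_abs]
    gcongr
  refine h3.trans ?_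
  set X := ‖Complex.exp (π * I * w ^ 2 / τ)‖
  set Y := Real.exp (-(π * τ) * |x| ^ 2 + 2 * π * τ * (|c| + b + ‖w / τ‖) * |x| +
        π * τ * (|c| + b + ‖w / τ‖) ^ 2)
  have : 0 ≤ X * Y := by positivity
  nlinarith

lemma tend_aux (a B C : ℝ) (ha : 0 < a) (K : ℝ) :
    Filter.Tendsto (fun R : ℝ => K * Real.exp (-a * |R| ^ 2 + B * |R| + C)) Filter.atTop (nhds 0) := by
  rw [← mul_zero K]
  apply Filter.Tendsto.const_mul
  apply Real.tendsto_exp_atBot.comp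
  apply Filter.tendsto_atBot_add_const_right
  have h1 : Filter.Tendsto (fun R : ℝ => R * (-a * R + B)) Filter.atTop Filter.atBot := by
    apply Filter.Tendsto.atTop_mul_atBot₀ Filter.tendsto_id
    apply Filter.tendsto_atBot_add_const_right
    exact Filter.tendsto_id.const_mul_atTop_of_neg (by linarith)
  refine h1.congr' ?_
  filter_upwards [Filter.eventually_ge_atTop 0] with R hR
  rw [abs_of_nonneg hR]; ring

/-- Contour lemma specialised. -/
lemma cross_gg (τ : ℝ) (hτ : 0 < τ) (w : ℂ) (c b b' : ℝ) (hb : 0 < b) (hbb : b < b') (q : ℂ → ℂ)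
    (hq : DifferentiableOn ℂ q {z : ℂ | |z.im| < b'})
    (hf : ∀ z : ℂ, z ≠ 0 → |z.im| < b' → om * gg τ w (c + om * z) = q z / z)
    (hi1 : Integrable (fun v : ℝ => om * gg τ w ((c + √2 * b : ℝ) + om * v)))
    (hi2 : Integrable (fun v : ℝ => om * gg τ w ((c - √2 * b : ℝ) + om * v))) :
    (∫ v : ℝ, om * gg τ w ((c + √2 * b : ℝ) + om * v)) -
      (∫ v : ℝ, om * gg τ w ((c - √2 * b : ℝ) + om * v)) = 2 * π * I * q 0 := by
  have e1 : ∀ x : ℝ, om * gg τ w (c + om * (x + ((-b : ℝ) : ℂ) * I)) =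
      (fun v : ℝ => om * gg τ w ((c + √2 * b : ℝ) + om * v)) (x - (-b)) := by
    intro x
    simp only []
    rw [om_coord, mul_neg, sub_neg_eq_add]
  have e2 : ∀ x : ℝ, om * gg τ w (c + om * (x + (b : ℂ) * I)) =
      (fun v : ℝ => om * gg τ w ((c - √2 * b : ℝ) + om * v)) (x - b) := by
    intro x
    simp only []
    rw [om_coord]
  have := cross_lemma q (fun z => om * gg τ w (c + om * z)) b b' hb hbb hq hf
    (by simp only [e1]; exact hi1.comp_sub_right _) (by simp only [e2]; exact hi2.comp_sub_right _)
    _ (tend_aux (π * τ) (2 * π * τ * (|c| + b + ‖w / τ‖)) (π * τ * (|c| + b + ‖w / τ‖) ^ 2)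
      (by positivity) (2 * ‖Complex.exp (π * I * w ^ 2 / τ)‖)) ?_ ?_
  · simp only [e1, e2] at this
    rw [integral_sub_right_eq_self (fun v : ℝ => om * gg τ w ((c + √2 * b : ℝ) + om * v)),
      integral_sub_right_eq_self (fun v : ℝ => om * gg τ w ((c - √2 * b : ℝ) + om * v))] at this
    exact this
  · filter_upwards [Filter.eventually_ge_atTop (b + 1)] with R hR y hy
    exact side_one τ hτ w c b R y hy (hR.trans (le_abs_self _))
  · filter_upwards [Filter.eventually_ge_atTop (b + 1)] with R hR y hy
    have := side_one τ hτ w c b (-R) y hy (by rw [abs_neg]; exact hR.trans (le_abs_self _))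
    rw [abs_neg] at this
    exact this

lemma shift_lt (τ : ℝ) (hτ : 0 < τ) (w : ℂ) (c c' : ℝ) (h0 : 0 < c) (h1 : c < c') (h2 : c' < 1) :
    (∫ v : ℝ, om * gg τ w ((c' : ℝ) + om * v)) = ∫ v : ℝ, om * gg τ w ((c : ℝ) + om * v) := by
  have hs := sq2
  have hs0 : 0 < √2 := by positivity
  set m := min ((c + c')/2) (1 - (c + c')/2) with hm
  have hmb : (c' - c)/2 < m := lt_min (by linarith) (by linarith)
  have eb : √2 * ((c' - c) * √2 / 4) = (c' - c)/2 := by linear_combination ((c' - c)/4) * hs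
  have ea : (c + c')/2 + √2 * ((c' - c) * √2 / 4) = c' := by rw [eb]; ring
  have ea' : (c + c')/2 - √2 * ((c' - c) * √2 / 4) = c := by rw [eb]; ring
  have hi1 := gg_int τ hτ w c' (by linarith) h2
  have hi2 := gg_int τ hτ w c h0 (by linarith)
  have key := cross_gg τ hτ w ((c + c')/2) ((c' - c) * √2 / 4) (m * √2 / 2)
    (by have : 0 < c' - c := by linarith
        positivity) (by nlinarith)
    (fun z => z * (om * gg τ w (((c + c')/2 : ℝ) + om * z))) ?_ ?_ (by rw [ea]; exact hi1)
    (by rw [ea']; exact hi2)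
  · rw [ea, ea', zero_mul, mul_zero] at key
    exact sub_eq_zero.1 key
  · intro z hz
    refine DifferentiableAt.differentiableWithinAt ?_
    refine differentiableAt_id.mul (DifferentiableAt.const_mul ?_ _)
    unfold gg
    refine DifferentiableAt.div ?_ (by fun_prop) ?_
    · exact (hh_diff τ w).differentiableAt.comp z (by fun_prop)
    · intro h
      rw [← Complex.re_add_im z] at h
      obtain ⟨-, n, hn⟩ := den_zero _ _ _ (sub_eq_zero.1 h)
      have hz' : |z.im| < m * √2 / 2 := hz
      have hz2 : |√2 * z.im| < m := by
        rw [abs_mul, abs_of_pos hs0]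
        nlinarith
      have := abs_lt.1 hz2
      have g1 := min_le_left ((c + c')/2) (1 - (c + c')/2)
      have g2 := min_le_right ((c + c')/2) (1 - (c + c')/2)
      have n1 : (0:ℝ) < n := by rw [← hn]; linarith
      have n2 : (n:ℝ) < 1 := by rw [← hn]; linarith
      have n1' : 0 < n := by exact_mod_cast n1
      have n2' : n < 1 := by exact_mod_cast n2
      omega
  · intro z hz _
    rw [mul_div_cancel_left₀ _ hz]

lemma shift (τ : ℝ) (hτ : 0 < τ) (w : ℂ) (c : ℝ) (h0 : 0 < c) (h2 : c < 1) :
    Upsilon w τ = ∫ v : ℝ, om * gg τ w ((c : ℝ) + om * v) := by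
  rw [Ups_eq]
  rcases lt_trichotomy c (1/2) with h | h | h
  · exact shift_lt τ hτ w c (1/2) h0 h (by norm_num)
  · rw [h]
  · exact (shift_lt τ hτ w (1/2) c (by norm_num) h h2).symm

lemma gg_shift (τ : ℝ) (w z : ℂ) : om * gg τ w (z + 1) =
    Complex.exp (2 * π * I * w - π * I * τ) * (om * gg τ (w - τ) z) := by
  have e1 : hh τ w (z + 1) = Complex.exp (2 * π * I * w - π * I * τ) * hh τ (w - τ) z := by
    rw [hh, hh, ← Complex.exp_add]; congr 1; ring
  have e2 : Complex.exp (2 * (π:ℂ) * I * (z + 1)) = Complex.exp (2 * (π:ℂ) * I * z) := by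
    rw [mul_add, mul_one, Complex.exp_add, Complex.exp_two_pi_mul_I, mul_one]
  rw [gg, gg, e1, e2]; ring

lemma E2 (τ : ℝ) (hτ : 0 < τ) (w : ℂ) :
    Complex.exp (2 * π * I * w - π * I * τ) * Upsilon (w - τ) τ - Upsilon w τ =
      Complex.exp (2 * π * I * w - π * I * τ) := by
  have hs := sq2
  have hs0 : 0 < √2 := by positivity
  have eb : √2 * (√2 / 4) = 1/2 := by linear_combination (1/4) * hs
  have ea : (1:ℝ) + √2 * (√2 / 4) = 3/2 := by rw [eb]; norm_num
  have ea' : (1:ℝ) - √2 * (√2 / 4) = 1/2 := by rw [eb]; norm_num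
  have e32 : ∀ v : ℝ, om * gg τ w ((3/2 : ℝ) + om * v) =
      Complex.exp (2 * π * I * w - π * I * τ) * (om * gg τ (w - τ) ((1/2 : ℝ) + om * v)) := by
    intro v
    rw [← gg_shift]; congr 2; push_cast; ring
  have hi1 : Integrable (fun v : ℝ => om * gg τ w ((3/2 : ℝ) + om * v)) := by
    simp only [e32]
    exact (gg_int τ hτ _ (1/2) (by norm_num) (by norm_num)).const_mul _
  have hi2 := gg_int τ hτ w (1/2) (by norm_num) (by norm_num)
  set e : ℂ → ℂ := fun z => Complex.exp (2 * (π:ℂ) * I * ((1:ℝ) + om * z)) with he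
  have ediff : Differentiable ℂ e := by simp only [he]; fun_prop
  have e0 : e 0 = 1 := by
    simp only [he]; rw [mul_zero, add_zero]; push_cast; rw [mul_one, Complex.exp_two_pi_mul_I]
  have ed0 : deriv e 0 = 2 * π * I * om := by
    have h1 : HasDerivAt (fun z : ℂ => 2 * (π:ℂ) * I * ((1:ℝ) + om * z)) (2 * π * I * om) 0 := by
      have := (((hasDerivAt_id (0:ℂ)).const_mul om).const_add ((1:ℝ):ℂ)).const_mul (2 * (π:ℂ) * I)
      simpa using this
    have h2 := h1.cexp
    have h3 : HasDerivAt e (2 * π * I * om) 0 := by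
      refine h2.congr_deriv ?_
      change e 0 * _ = _
      rw [e0, one_mul]
    exact h3.deriv
  have hE : Differentiable ℂ (dslope e 0) := by
    rw [← differentiableOn_univ] at ediff ⊢
    exact (Complex.differentiableOn_dslope Filter.univ_mem).2 ediff
  have hpio : 2 * (π:ℂ) * I * om ≠ 0 := mul_ne_zero Complex.two_pi_I_ne_zero om_ne
  have hEn : ∀ z : ℂ, |z.im| < √2 / 2 → dslope e 0 z ≠ 0 := by
    intro z hz
    by_cases hz0 : z = 0
    · rw [hz0, dslope_same, ed0]; exact hpio
    · rw [dslope_of_ne _ hz0, slope_def_field, e0, sub_zero]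
      refine div_ne_zero (fun h => hz0 ?_) hz0
      have h' := sub_eq_zero.1 h
      simp only [he] at h'
      rw [← Complex.re_add_im z] at h'
      obtain ⟨hxy, n, hn⟩ := den_zero _ _ _ h'
      have hz2 : |√2 * z.im| < 1 := by
        rw [abs_mul, abs_of_pos hs0]
        nlinarith
      have := abs_lt.1 hz2
      have n1 : (0:ℝ) < n := by rw [← hn]; linarith
      have n2 : (n:ℝ) < 2 := by rw [← hn]; linarith
      have n1' : 0 < n := by exact_mod_cast n1
      have n2' : n < 2 := by exact_mod_cast n2
      have : n = 1 := by omega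
      rw [this] at hn
      push_cast at hn
      have hy : √2 * z.im = 0 := by linarith
      have hy : z.im = 0 := by simpa using hy
      rw [← Complex.re_add_im z, hxy, hy]; simp
  have key := cross_gg τ hτ w 1 (√2 / 4) (√2 / 2) (by positivity) (by linarith)
    (fun z => om * hh τ w ((1:ℝ) + om * z) / dslope e 0 z) ?_ ?_ (by rw [ea]; exact hi1)
    (by rw [ea']; exact hi2)
  · rw [ea, ea', ← Ups_eq] at key
    simp only [e32] at key
    rw [integral_const_mul, ← Ups_eq] at key
    rw [key, dslope_same, ed0, mul_zero, add_zero]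
    have : hh τ w ((1:ℝ):ℂ) = Complex.exp (2 * π * I * w - π * I * τ) := by
      rw [hh]; congr 1; push_cast; ring
    rw [this]
    have h1 := om_ne
    have h2 := Complex.two_pi_I_ne_zero
    field_simp
  · intro z hz
    refine DifferentiableAt.differentiableWithinAt ?_
    refine DifferentiableAt.div (DifferentiableAt.const_mul ?_ _) hE.differentiableAt (hEn z hz)
    exact (hh_diff τ w).differentiableAt.comp z (by fun_prop)
  · intro z hz _
    rw [dslope_of_ne _ hz, slope_def_field, e0, sub_zero, gg]
    simp only [he]
    field_simp

lemma base1 (τ : ℝ) (hτ : 0 < τ) (hτ1 : τ ≤ 1) (x y : ℝ) (hx0 : 0 ≤ x) (hx1 : x ≤ 1)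
    (hy : |y| ≤ √τ) : ‖Upsilon (x + y * I) τ‖ ≤
      8 * Real.exp (2 * π) * √2 * Real.exp (9 * π / 2) * (√τ)⁻¹ := by
  have hpi := Real.pi_pos
  have hst : √τ * √τ = τ := Real.mul_self_sqrt hτ.le
  have hst0 : 0 < √τ := Real.sqrt_pos.2 hτ
  have hst1 : √τ ≤ 1 := by rw [← Real.sqrt_one]; exact Real.sqrt_le_sqrt hτ1
  have hts : τ ≤ √τ := by nlinarith
  have hs20 : 0 < √2 := by positivity
  have hs2 : √2 ≤ 2 := by nlinarith [sq2]
  have hpt : ∀ v : ℝ, ‖om * gg τ (x + y * I) ((1/2 : ℝ) + om * v)‖ ≤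
      8 * Real.exp (2 * π) * Real.exp (-(π * τ) * v ^ 2 + (3 * π * √τ) * |v|) := by
    intro v
    have hd := den_lb (1/2) (1/2) v (by norm_num) le_rfl le_rfl (by norm_num)
    have hn := num_bound τ hτ 0 ((1/2 : ℝ) : ℂ) v
    have hε : ‖((1/2 : ℝ) : ℂ) - 0 / (τ : ℂ)‖ = 1/2 := by rw [zero_div, sub_zero]; simp
    have h0 : ‖Complex.exp (π * I * (0:ℂ) ^ 2 / τ)‖ = 1 := by simp
    rw [hε, h0, one_mul] at hn
    have hsplit : hh τ (x + y * I) ((1/2 : ℝ) + om * v) = hh τ 0 ((1/2 : ℝ) + om * v) *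
        Complex.exp (2 * π * I * (x + y * I) * ((1/2 : ℝ) + om * v)) := by
      rw [hh, hh, ← Complex.exp_add]; congr 1; ring
    have hre : (2 * π * I * (x + y * I) * ((1/2 : ℝ) + om * v)).re =
        -(√2 * π * v) * x - 2 * π * y * (1/2 - √2/2 * v) := by
      simp [om_re, om_im]; ring
    set Mx := max 1 (Real.exp (-(√2 * π * v))) with hMx
    have hM1 : Real.exp (-(√2 * π * v) * x) ≤ Mx := by
      rcases le_total 0 v with h | h
      · refine le_trans ?_ (le_max_left _ _)
        apply Real.exp_le_one_iff.2
        have : 0 ≤ √2 * π * v * x := by positivity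
        linarith
      · refine le_trans ?_ (le_max_right _ _)
        apply Real.exp_le_exp.2
        have : 0 ≤ √2 * π * (-v) := mul_nonneg (by positivity) (by linarith)
        nlinarith
    have hE : ‖Complex.exp (2 * π * I * (x + y * I) * ((1/2 : ℝ) + om * v))‖ ≤
        Mx * Real.exp (π * √τ + 2 * π * √τ * |v|) := by
      rw [Complex.norm_exp, hre, sub_eq_add_neg, Real.exp_add]
      have h1 : |y * (1/2 - √2/2 * v)| ≤ √τ * (1/2 + |v|) := by
        rw [abs_mul]
        gcongr
        refine (abs_sub _ _).trans ?_
        rw [abs_mul, abs_of_pos (by positivity : (0:ℝ) < 1/2), abs_of_pos (by positivity : (0:ℝ) < √2/2)]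
        have : √2/2 * |v| ≤ 1 * |v| := by gcongr; linarith
        linarith
      have h2 : -(2 * π * y * (1/2 - √2/2 * v)) ≤ π * √τ + 2 * π * √τ * |v| := by
        have h3 := (abs_le.1 h1).1
        have h4 : 2 * π * (-(y * (1/2 - √2/2 * v))) ≤ 2 * π * (√τ * (1/2 + |v|)) := by
          gcongr; linarith
        linarith
      gcongr
    have hMp : 0 < Mx := lt_of_lt_of_le one_pos (le_max_left _ _)
    rw [norm_mul, om_norm, one_mul, gg, norm_div, hsplit, norm_mul,
      div_le_iff₀ (lt_of_lt_of_le (by positivity) hd)]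
    calc _ ≤ Real.exp (-(π * τ) * v ^ 2 + 2 * π * τ * (1/2) * |v| + π * τ * (1/2) ^ 2) *
          (Mx * Real.exp (π * √τ + 2 * π * √τ * |v|)) := by gcongr
      _ = Mx * Real.exp ((-(π * τ) * v ^ 2 + 2 * π * τ * (1/2) * |v| + π * τ * (1/2) ^ 2) +
          (π * √τ + 2 * π * √τ * |v|)) := by rw [Real.exp_add _ (π * √τ + 2 * π * √τ * |v|)]; ring
      _ ≤ Mx * Real.exp (2 * π + (-(π * τ) * v ^ 2 + (3 * π * √τ) * |v|)) := by
          have h1 : π * τ * |v| ≤ π * √τ * |v| := by gcongr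
          have h2 : π * τ ≤ π * 1 := by gcongr
          have h3 : π * √τ ≤ π * 1 := by gcongr
          apply mul_le_mul_of_nonneg_left _ hMp.le
          apply Real.exp_le_exp.2
          linarith
      _ = 8 * Real.exp (2 * π) * Real.exp (-(π * τ) * v ^ 2 + (3 * π * √τ) * |v|) * (1/2/4 * Mx) := by
          rw [Real.exp_add (2 * π)]; ring
      _ ≤ _ := by gcongr
  rw [Ups_eq]
  have hI := int_bound (π * τ) (3 * π * √τ) (by positivity)
  refine (norm_integral_le_of_norm_le (hI.const_mul _) (Filter.Eventually.of_forall hpt)).trans ?_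
  rw [integral_const_mul]
  have h2 := int_bound_le (π * τ) (3 * π * √τ) (by positivity)
  have e1 : √(2 * π / (π * τ)) = √2 * (√τ)⁻¹ := by
    rw [show 2 * π / (π * τ) = 2 * τ⁻¹ by field_simp, Real.sqrt_mul (by norm_num), Real.sqrt_inv]
  have e2 : (3 * π * √τ) ^ 2 / (2 * (π * τ)) = 9 * π / 2 := by
    rw [mul_pow, Real.sq_sqrt hτ.le]; field_simp; norm_num
  rw [e1, e2] at h2
  calc _ ≤ 8 * Real.exp (2 * π) * (√2 * (√τ)⁻¹ * Real.exp (9 * π / 2)) := by gcongr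
    _ = _ := by ring

lemma base2 (τ : ℝ) (hτ1 : 1 ≤ τ) (x y : ℝ) (hx0 : 0 ≤ x) (hx1 : x ≤ 1)
    (hy : |y| ≤ √τ) : ‖Complex.exp (-(π * I * ((τ * x : ℝ) + y * I) ^ 2 / τ)) *
      Upsilon ((τ * x : ℝ) + y * I) τ‖ ≤
      16 * Real.exp (4 * π) * √2 * Real.exp (8 * π) := by
  have hτ : 0 < τ := by linarith
  have hpi := Real.pi_pos
  have hst : √τ * √τ = τ := Real.mul_self_sqrt hτ.le
  have hst0 : 0 < √τ := Real.sqrt_pos.2 hτ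
  have hst1 : 1 ≤ √τ := by rw [Real.one_le_sqrt]; exact hτ1
  have hinv : (√τ)⁻¹ ≤ 1 := inv_le_one_of_one_le₀ hst1
  have hinv0 : 0 < (√τ)⁻¹ := by positivity
  set w : ℂ := (τ * x : ℝ) + y * I with hw
  set δ := (√τ)⁻¹ / 4 with hδ
  have hδ0 : 0 < δ := by positivity
  obtain ⟨c, hc1, hc2, hc3⟩ : ∃ c, δ ≤ c ∧ c ≤ 1 - δ ∧ |c - x| ≤ δ := by
    by_cases h1 : x < δ
    · exact ⟨δ, le_rfl, by linarith, by rw [abs_le]; constructor <;> linarith⟩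
    · by_cases h2 : 1 - δ < x
      · exact ⟨1 - δ, by linarith, le_rfl, by rw [abs_le]; constructor <;> linarith⟩
      · exact ⟨x, by linarith, by linarith, by simp; linarith⟩
  have hε : ‖(c:ℂ) - w / τ‖ ≤ 2 * (√τ)⁻¹ := by
    have ht : (τ : ℂ) ≠ 0 := by exact_mod_cast hτ.ne'
    have e : (c:ℂ) - w / τ = ((c - x : ℝ) : ℂ) - ((y / τ : ℝ) : ℂ) * I := by
      rw [hw]; push_cast; field_simp; ring
    rw [e]
    refine (norm_sub_le _ _).trans ?_
    rw [norm_mul, Complex.norm_I, mul_one, Complex.norm_real, Complex.norm_real, Real.norm_eq_abs,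
      Real.norm_eq_abs, abs_div, abs_of_pos hτ]
    have : |y| / τ ≤ (√τ)⁻¹ := by
      rw [div_le_iff₀ hτ]
      have e3 : (√τ)⁻¹ * τ = √τ := by nth_rewrite 2 [← hst]; field_simp
      rw [e3]; exact hy
    linarith
  set K := ‖Complex.exp (π * I * w ^ 2 / τ)‖ with hK
  have hpt : ∀ v : ℝ, ‖om * gg τ w (c + om * v)‖ ≤
      16 * √τ * K * Real.exp (4 * π) * Real.exp (-(π * τ) * v ^ 2 + (4 * π * √τ) * |v|) := by
    intro v
    refine (gg_bound τ hτ w δ c v hδ0 (by linarith) hc1 hc2).trans ?_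
    have e4 : 4 / δ = 16 * √τ := by rw [hδ]; field_simp; norm_num
    have e5 : τ * (√τ)⁻¹ = √τ := by nth_rewrite 1 [← hst]; field_simp
    have e6 : τ * (√τ)⁻¹ ^ 2 = 1 := by rw [sq, ← mul_assoc, e5]; field_simp
    rw [e4, mul_assoc (16 * √τ * K), ← Real.exp_add, mul_assoc (16 * √τ)]
    refine mul_le_mul_of_nonneg_left (mul_le_mul_of_nonneg_left (Real.exp_le_exp.2 ?_) (norm_nonneg _)) (by positivity)
    calc -(π * τ) * v ^ 2 + 2 * π * τ * ‖(c:ℂ) - w / τ‖ * |v| + π * τ * ‖(c:ℂ) - w / τ‖ ^ 2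
        ≤ -(π * τ) * v ^ 2 + 2 * π * τ * (2 * (√τ)⁻¹) * |v| + π * τ * (2 * (√τ)⁻¹) ^ 2 := by gcongr
      _ = 4 * π + (-(π * τ) * v ^ 2 + 4 * π * √τ * |v|) := by
          linear_combination (4 * π * |v|) * e5 + (4 * π) * e6
  have hU : ‖Upsilon w τ‖ ≤ K * (16 * Real.exp (4 * π) * √2 * Real.exp (8 * π)) := by
    rw [shift τ hτ w c (by linarith) (by linarith)]
    have hI := int_bound (π * τ) (4 * π * √τ) (by positivity)
    refine (norm_integral_le_of_norm_le (hI.const_mul _) (Filter.Eventually.of_forall hpt)).trans ?_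
    rw [integral_const_mul]
    have h2 := int_bound_le (π * τ) (4 * π * √τ) (by positivity)
    have e1 : √(2 * π / (π * τ)) = √2 * (√τ)⁻¹ := by
      rw [show 2 * π / (π * τ) = 2 * τ⁻¹ by field_simp, Real.sqrt_mul (by norm_num), Real.sqrt_inv]
    have e2 : (4 * π * √τ) ^ 2 / (2 * (π * τ)) = 8 * π := by
      rw [mul_pow, Real.sq_sqrt hτ.le]; field_simp; norm_num
    rw [e1, e2] at h2
    calc _ ≤ 16 * √τ * K * Real.exp (4 * π) * (√2 * (√τ)⁻¹ * Real.exp (8 * π)) := by gcongr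
      _ = _ := by field_simp
  rw [norm_mul]
  have hKK : ‖Complex.exp (-(π * I * w ^ 2 / τ))‖ * K = 1 := by
    rw [hK, ← norm_mul, ← Complex.exp_add]; simp
  calc _ ≤ ‖Complex.exp (-(π * I * w ^ 2 / τ))‖ * (K * (16 * Real.exp (4 * π) * √2 * Real.exp (8 * π))) := by
        gcongr
    _ = _ := by rw [← mul_assoc, hKK, one_mul]

lemma telescope (P : ℝ → ℂ) (A B X : ℝ) (hB : 0 ≤ B) (h0 : ∀ x, 0 ≤ x → x ≤ 1 → ‖P x‖ ≤ A)
    (h1 : ∀ x, |x| ≤ X → ‖P (x + 1) - P x‖ ≤ B) (x : ℝ) (hx : |x| ≤ X) :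
    ‖P x‖ ≤ A + B * (|x| + 1) := by
  have key : ∀ n : ℕ, ∀ x, |x| ≤ X → |x| ≤ n → ‖P x‖ ≤ A + B * n := by
    intro n
    induction n with
    | zero =>
      intro x _ h
      have : x = 0 := by simpa using h
      rw [this]; simpa using h0 0 le_rfl zero_le_one
    | succ n ih =>
      intro x hX hn
      have hBn : 0 ≤ B * n := by positivity
      push_cast at hn ⊢
      by_cases hx0 : 0 ≤ x
      · rw [abs_of_nonneg hx0] at hX hn
        by_cases hx1 : x ≤ 1
        · linarith [h0 x hx0 hx1]
        · push Not at hx1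
          have ha : |x - 1| = x - 1 := abs_of_nonneg (by linarith)
          have e := h1 (x - 1) (by rw [ha]; linarith)
          have i := ih (x - 1) (by rw [ha]; linarith) (by rw [ha]; linarith)
          rw [sub_add_cancel] at e
          have := norm_add_le (P x - P (x - 1)) (P (x - 1))
          rw [sub_add_cancel] at this
          linarith
      · push Not at hx0
        have e := h1 x hX
        rw [abs_of_neg hx0] at hX hn
        have hP : ‖P (x + 1)‖ ≤ A + B * n := by
          by_cases hx1 : -1 ≤ x
          · linarith [h0 (x + 1) (by linarith) (by linarith)]
          · push Not at hx1
            have ha : |x + 1| = -(x + 1) := abs_of_nonpos (by linarith)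
            exact ih (x + 1) (by rw [ha]; linarith) (by rw [ha]; linarith)
        have := norm_sub_le (P (x + 1)) (P (x + 1) - P x)
        rw [sub_sub_cancel] at this
        linarith
  refine (key ⌈|x|⌉₊ x hx (Nat.le_ceil _)).trans ?_
  have := (Nat.ceil_lt_add_one (abs_nonneg x)).le
  gcongr

lemma norm_gauss (a y r : ℝ) : ‖Complex.exp (π * I * (a + y * I) ^ 2 * r)‖ =
    Real.exp (-(2 * π * r * (a * y))) := by
  rw [Complex.norm_exp]
  congr 1
  simp [sq]
  ring

lemma Ups_small : ∃ C : ℝ, 0 ≤ C ∧ ∀ a t τ : ℝ, |t| ≤ 1 → |a * t| ≤ 1 → 0 < τ → τ ≤ 1 →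
    ‖Upsilon ((√τ * a : ℝ) + (√τ * t : ℝ) * I) τ‖ ≤ C * (√τ)⁻¹ * (1 + √τ * |a|) := by
  set D := 8 * Real.exp (2 * π) * √2 * Real.exp (9 * π / 2) with hD
  have hD0 : 0 ≤ D := by positivity
  refine ⟨D + Real.exp (2 * π), by positivity, ?_⟩
  intro a t τ ht hat hτ hτ1
  have hpi := Real.pi_pos
  have hst : √τ * √τ = τ := Real.mul_self_sqrt hτ.le
  have hst0 : 0 < √τ := Real.sqrt_pos.2 hτ
  have hT := telescope (fun x => Upsilon (x + (√τ * t : ℝ) * I) τ) (D * (√τ)⁻¹)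
    ((√τ)⁻¹ * Real.exp (2 * π)) (√τ * |a|) (by positivity)
    (fun x h0 h1 => base1 τ hτ hτ1 x _ h0 h1 (by
      rw [abs_mul, abs_of_pos hst0]; nlinarith)) ?_ (√τ * a) (by rw [abs_mul, abs_of_pos hst0])
  · refine hT.trans ?_
    rw [abs_mul, abs_of_pos hst0]
    have h1 : 0 ≤ D * (√τ)⁻¹ * (√τ * |a|) := by positivity
    nlinarith
  · intro x hx
    have h := E1 τ hτ (x + (√τ * t : ℝ) * I)
    have e : (x:ℂ) + (√τ * t : ℝ) * I + 1 = ((x + 1 : ℝ) : ℂ) + (√τ * t : ℝ) * I := by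
      push_cast; ring
    rw [e] at h
    refine h.trans ?_
    gcongr
    rw [div_eq_mul_inv, ← Complex.ofReal_inv, norm_gauss]
    apply Real.exp_le_exp.2
    have h2 : |τ⁻¹ * (x * (√τ * t))| ≤ 1 := by
      rw [abs_mul, abs_mul, abs_mul, abs_of_pos hst0, abs_of_pos (inv_pos.2 hτ), inv_mul_le_iff₀ hτ]
      rw [abs_mul] at hat
      calc |x| * (√τ * |t|) ≤ (√τ * |a|) * (√τ * |t|) := by gcongr
        _ = τ * (|a| * |t|) := by rw [← hst]; ring_nf; simp [hst0.le]
        _ ≤ τ * 1 := by gcongr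
    have h3 := (abs_le.1 h2).1
    nlinarith

lemma Ups_large : ∃ C : ℝ, 0 ≤ C ∧ ∀ a t τ : ℝ, |t| ≤ 1 → |a * t| ≤ 1 → 1 ≤ τ →
    ‖Upsilon ((√τ * a : ℝ) + (√τ * t : ℝ) * I) τ‖ ≤ C * (1 + (√τ)⁻¹ * |a|) := by
  set D := 16 * Real.exp (4 * π) * √2 * Real.exp (8 * π) with hD
  have hD0 : 0 ≤ D := by positivity
  refine ⟨Real.exp (2 * π) * (D + Real.exp (2 * π)), by positivity, ?_⟩
  intro a t τ ht hat hτ1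
  have hτ : 0 < τ := by linarith
  have hpi := Real.pi_pos
  have hst : √τ * √τ = τ := Real.mul_self_sqrt hτ.le
  have hst0 : 0 < √τ := Real.sqrt_pos.2 hτ
  have htc : (τ : ℂ) ≠ 0 := by exact_mod_cast hτ.ne'
  have hT := telescope (fun x => Complex.exp (-(π * I * ((τ * x : ℝ) + (√τ * t : ℝ) * I) ^ 2 / τ)) *
      Upsilon ((τ * x : ℝ) + (√τ * t : ℝ) * I) τ) D
    (Real.exp (2 * π)) ((√τ)⁻¹ * |a|) (by positivity)
    (fun x h0 h1 => base2 τ hτ1 x _ h0 h1 (by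
      rw [abs_mul, abs_of_pos hst0]; nlinarith)) ?_ ((√τ)⁻¹ * a)
      (by rw [abs_mul, abs_of_pos (inv_pos.2 hst0)])
  · have e1 : τ * ((√τ)⁻¹ * a) = √τ * a := by nth_rewrite 1 [← hst]; field_simp
    simp only [e1] at hT
    rw [abs_mul, abs_of_pos (inv_pos.2 hst0), norm_mul] at hT
    set Y := ‖Upsilon ((√τ * a : ℝ) + (√τ * t : ℝ) * I) τ‖ with hY
    set E := ‖Complex.exp (-(π * I * ((√τ * a : ℝ) + (√τ * t : ℝ) * I) ^ 2 / τ))‖ with hE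
    have hE' : Real.exp (-(2 * π)) ≤ E := by
      rw [hE, show -(π * I * (((√τ * a : ℝ) : ℂ) + (√τ * t : ℝ) * I) ^ 2 / τ) =
        π * I * (((√τ * a : ℝ) : ℂ) + (√τ * t : ℝ) * I) ^ 2 * ((-τ⁻¹ : ℝ) : ℂ) by push_cast; ring,
        norm_gauss]
      apply Real.exp_le_exp.2
      have : -τ⁻¹ * (√τ * a * (√τ * t)) = -(a * t) := by
        rw [show √τ * a * (√τ * t) = (√τ * √τ) * (a * t) by ring, hst]; field_simp
      rw [mul_assoc (2 * π), this]
      have := (abs_le.1 hat).1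
      nlinarith
    have hY0 : 0 ≤ Y := norm_nonneg _
    have h3 : Y ≤ Real.exp (2 * π) * (E * Y) := by
      calc Y = Real.exp (2 * π) * (Real.exp (-(2 * π)) * Y) := by
            rw [← mul_assoc, ← Real.exp_add]; simp
        _ ≤ _ := by gcongr
    refine h3.trans ?_
    rw [mul_assoc]
    refine mul_le_mul_of_nonneg_left ?_ (Real.exp_pos _).le
    refine hT.trans ?_
    have h1 : 0 ≤ D * ((√τ)⁻¹ * |a|) := by positivity
    nlinarith
  · intro x hx
    set w : ℂ := (τ * x : ℝ) + (√τ * t : ℝ) * I with hw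
    have ew : ((τ * (x + 1) : ℝ) : ℂ) + (√τ * t : ℝ) * I = w + τ := by
      rw [hw]; push_cast; ring
    have h := E2 τ hτ (w + τ)
    rw [add_sub_cancel_right] at h
    have eK : Complex.exp (-(π * I * (w + τ) ^ 2 / τ)) * Complex.exp (2 * π * I * (w + τ) - π * I * τ)
        = Complex.exp (-(π * I * w ^ 2 / τ)) := by
      rw [← Complex.exp_add]; congr 1; field_simp; ring
    simp only [ew]
    have e2 : Complex.exp (-(π * I * (w + τ) ^ 2 / τ)) * Upsilon (w + τ) τ -
        Complex.exp (-(π * I * w ^ 2 / τ)) * Upsilon w τ = -Complex.exp (-(π * I * w ^ 2 / τ)) := by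
      linear_combination (-Complex.exp (-(π * I * (w + τ) ^ 2 / τ))) * h + (Upsilon w τ - 1) * eK
    rw [e2, norm_neg, show -(π * I * w ^ 2 / τ) = π * I * w ^ 2 * ((-τ⁻¹ : ℝ) : ℂ) by push_cast; ring,
      hw, norm_gauss]
    apply Real.exp_le_exp.2
    have e3 : -τ⁻¹ * (τ * x * (√τ * t)) = -(x * √τ * t) := by field_simp
    rw [mul_assoc (2 * π), e3]
    have h2 : |x * √τ * t| ≤ 1 := by
      rw [abs_mul, abs_mul, abs_of_pos hst0]
      rw [abs_mul] at hat
      calc |x| * √τ * |t| ≤ ((√τ)⁻¹ * |a|) * √τ * |t| := by gcongr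
        _ = |a| * |t| := by field_simp
        _ ≤ 1 := hat
    have h3 := (abs_le.1 h2).2
    nlinarith

lemma G_norm (u : ℂ) (τ : ℝ) (hτ : 0 < τ) (h : |u.re * u.im| ≤ 1) : ‖G u τ‖ ≤ Real.exp π *
    τ ^ ((1:ℝ)/4) * ‖Upsilon ((√τ * u.re : ℝ) + (√τ * u.im : ℝ) * I) τ‖ := by
  have hpi := Real.pi_pos
  have e1 : ((τ:ℂ) ^ ((1:ℂ)/2)) * u = (√τ * u.re : ℝ) + (√τ * u.im : ℝ) * I := by
    have : ((1:ℂ)/2) = ((1/2 : ℝ) : ℂ) := by push_cast; rfl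
    rw [this, ← Complex.ofReal_cpow hτ.le, ← Real.sqrt_eq_rpow]
    nth_rewrite 1 [← Complex.re_add_im u]
    push_cast; ring
  have e2 : ‖(τ:ℂ) ^ ((1:ℂ)/4)‖ = τ ^ ((1:ℝ)/4) := by
    rw [Complex.norm_cpow_eq_rpow_re_of_pos hτ]
    congr 1
    norm_num
  rw [G, norm_mul, norm_mul, e1, e2, mul_comm (Real.exp π)]
  gcongr
  rw [Complex.norm_exp]
  apply Real.exp_le_exp.2
  have : (-(π:ℂ) * I * u ^ 2 / 2 + π * I / 8).re = π * (u.re * u.im) := by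
    have : (-(π:ℂ) * I * u ^ 2 / 2 + π * I / 8) = ((-π/2 : ℝ) : ℂ) * (I * (u * u)) + ((π/8 : ℝ) : ℂ) * I := by
      push_cast; ring
    rw [this, Complex.add_re, Complex.re_ofReal_mul, Complex.re_ofReal_mul]
    simp
    ring
  rw [this]
  have := (abs_le.1 h).2
  nlinarith

lemma cauchy_step (k : ℕ) (u τ M : ℝ) (hτ : 0 < τ)
    (hM : ∀ z : ℂ, |z.re| ≤ |u| + 1 → |z.im| ≤ 1 → |z.re * z.im| ≤ 1 → ‖G z τ‖ ≤ M) :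
    ‖Gderiv k (u:ℂ) (τ:ℂ)‖ ≤ (k.factorial * 2 ^ k) * M * (1 + |u| ^ k) := by
  have hG : Differentiable ℂ (fun w => G w τ) := by
    unfold G
    have h := (Ups_diff τ hτ).comp (show Differentiable ℂ (fun w : ℂ => (τ:ℂ) ^ ((1:ℂ)/2) * w) by fun_prop)
    have h' : Differentiable ℂ (fun w : ℂ => Upsilon ((τ:ℂ) ^ ((1:ℂ)/2) * w) τ) := h
    exact Differentiable.mul (by fun_prop) h'
  have hu : 0 < 1 + |u| := by positivity
  have hM0 : 0 ≤ M := (norm_nonneg _).trans (hM 0 (by simp; positivity) (by simp) (by simp))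
  have key := Complex.norm_iteratedDeriv_le_of_forall_mem_sphere_norm_le (c := (u:ℂ))
    (R := (1 + |u|)⁻¹) (C := M) (f := fun w => G w τ) k (by positivity) hG.diffContOnCl ?_
  · rw [Gderiv]
    refine key.trans ?_
    rw [inv_pow, div_inv_eq_mul]
    have hp : (1 + |u|) ^ k ≤ 2 ^ k * (1 + |u| ^ k) := by
      have h1 := add_pow_le (zero_le_one) (abs_nonneg u) k
      rw [one_pow] at h1
      refine h1.trans ?_
      gcongr
      · norm_num
      · omega
    calc (k.factorial : ℝ) * M * (1 + |u|) ^ k ≤ k.factorial * M * (2 ^ k * (1 + |u| ^ k)) := by gcongr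
      _ = _ := by ring
  · intro z hz
    have hz' : ‖z - u‖ = (1 + |u|)⁻¹ := by simpa [dist_eq_norm] using hz
    have hr1 : (1 + |u|)⁻¹ ≤ 1 := inv_le_one_of_one_le₀ (by linarith [abs_nonneg u])
    have him : |z.im| ≤ (1 + |u|)⁻¹ := by
      have := Complex.abs_im_le_norm (z - u)
      simpa [hz'] using this
    have hre : |z.re| ≤ |u| + 1 := by
      have := Complex.abs_re_le_norm (z - u)
      rw [hz'] at this
      simp at this
      have h2 := abs_add_le (z.re - u) u
      rw [sub_add_cancel] at h2
      linarith
    refine hM z hre (him.trans hr1) ?_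
    rw [abs_mul]
    calc |z.re| * |z.im| ≤ (|u| + 1) * (1 + |u|)⁻¹ := by gcongr
      _ = 1 := by rw [add_comm]; field_simp
      _ ≤ 1 := le_rfl

theorem statement12 (k : ℕ) :
    ∃ C : ℝ, ∀ u τ : ℝ, 0 < τ →
      (τ ≤ 1 → ‖Gderiv k (u:ℂ) (τ:ℂ)‖ ≤
          C * τ ^ (-(1:ℝ)/4) * (1 + τ ^ ((1:ℝ)/2) * |u|) *
            (1 + τ ^ (-(k:ℝ)/2) + |u|^k)) ∧
      (1 ≤ τ → ‖Gderiv k (u:ℂ) (τ:ℂ)‖ ≤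
          C * τ ^ ((1:ℝ)/4) * (1 + τ ^ (-(1:ℝ)/2) * |u|) *
            (1 + τ ^ ((k:ℝ)/2) + |u|^k)) := by
  obtain ⟨C1, hC1, H1⟩ := Ups_small
  obtain ⟨C2, hC2, H2⟩ := Ups_large
  refine ⟨(k.factorial * 2 ^ k) * (Real.exp π * ((C1 + C2) * 2)), ?_⟩
  intro u τ hτ
  have hst0 : 0 < √τ := Real.sqrt_pos.2 hτ
  have es : τ ^ ((1:ℝ)/2) = √τ := (Real.sqrt_eq_rpow τ).symm
  have es' : τ ^ (-(1:ℝ)/2) = (√τ)⁻¹ := by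
    rw [neg_div, Real.rpow_neg hτ.le, es]
  have e4 : τ ^ ((1:ℝ)/4) * (√τ)⁻¹ = τ ^ (-(1:ℝ)/4) := by
    rw [← es', ← Real.rpow_add hτ]; norm_num
  have hq1 : 0 < τ ^ (-(1:ℝ)/4) := Real.rpow_pos_of_pos hτ _
  have hq2 : 0 < τ ^ ((1:ℝ)/4) := Real.rpow_pos_of_pos hτ _
  constructor
  · intro hτ1
    have hst1 : √τ ≤ 1 := by rw [← Real.sqrt_one]; exact Real.sqrt_le_sqrt hτ1
    have h := cauchy_step k u τ (Real.exp π * (C1 + C2) * τ ^ (-(1:ℝ)/4) * (2 * (1 + √τ * |u|))) hτ ?_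
    · rw [es]
      refine h.trans ?_
      have hk : 0 < τ ^ (-(k:ℝ)/2) := Real.rpow_pos_of_pos hτ _
      calc _ = (k.factorial * 2 ^ k) * (Real.exp π * ((C1 + C2) * 2)) * τ ^ (-(1:ℝ)/4) *
            (1 + √τ * |u|) * (1 + |u| ^ k) := by ring
        _ ≤ _ := by
          gcongr
          linarith
    · intro z hre him hri
      refine (G_norm z τ hτ hri).trans ?_
      calc _ ≤ Real.exp π * τ ^ ((1:ℝ)/4) * (C1 * (√τ)⁻¹ * (1 + √τ * |z.re|)) := by
            gcongr; exact H1 _ _ τ him hri hτ hτ1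
        _ = Real.exp π * C1 * τ ^ (-(1:ℝ)/4) * (1 + √τ * |z.re|) := by rw [← e4]; ring
        _ ≤ _ := by
          gcongr
          · linarith
          · have : √τ * |z.re| ≤ √τ * (|u| + 1) := by gcongr
            have h3 : 0 ≤ √τ * |u| := by positivity
            linarith
  · intro hτ1
    have hst1 : 1 ≤ √τ := by rw [Real.one_le_sqrt]; exact hτ1
    have hinv : (√τ)⁻¹ ≤ 1 := inv_le_one_of_one_le₀ hst1
    have h := cauchy_step k u τ (Real.exp π * (C1 + C2) * τ ^ ((1:ℝ)/4) * (2 * (1 + (√τ)⁻¹ * |u|))) hτ ?_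
    · rw [es']
      refine h.trans ?_
      have hk : 0 < τ ^ ((k:ℝ)/2) := Real.rpow_pos_of_pos hτ _
      calc _ = (k.factorial * 2 ^ k) * (Real.exp π * ((C1 + C2) * 2)) * τ ^ ((1:ℝ)/4) *
            (1 + (√τ)⁻¹ * |u|) * (1 + |u| ^ k) := by ring
        _ ≤ _ := by
          gcongr
          linarith
    · intro z hre him hri
      refine (G_norm z τ hτ hri).trans ?_
      calc _ ≤ Real.exp π * τ ^ ((1:ℝ)/4) * (C2 * (1 + (√τ)⁻¹ * |z.re|)) := by
            gcongr; exact H2 _ _ τ him hri hτ1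
        _ = Real.exp π * C2 * τ ^ ((1:ℝ)/4) * (1 + (√τ)⁻¹ * |z.re|) := by ring
        _ ≤ _ := by
          gcongr
          · linarith
          · have : (√τ)⁻¹ * |z.re| ≤ (√τ)⁻¹ * (|u| + 1) := by gcongr
            have h3 : 0 ≤ (√τ)⁻¹ * |u| := by positivity
            linarith

end
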